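/- Let d ∈ N and let w : Z^d → (0,∞) be a weight. The following seven conditions are equivalent: (i) every f ∈ F_d(w) belongs to the Wiener algebra A(T^d) and the inclusion map F_d(w) → A(T^d) is compact; (ii) this inclusion is bounded; (iii) every f ∈ F_d(w) has a continuous representative and the inclusion F_d(w) → C(T^d) is compact; (iv) this inclusion is bounded; (v) every f ∈ F_d(w) lies in L∞(T^d) and the inclusion F_d(w) → L∞(T^d) is compact; (vi) this inclusion is bounded; (vii) ∑_{k∈Z^d} w(k)^{-2} < ∞. -/

import Mathlib

open MeasureTheory Filter
open scoped ENNReal NNReal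

noncomputable section

/-- The index lattice `ℤ^d`. -/
abbrev ZLat (d : ℕ) := Fin d → ℤ

instance fact_two_pi_pos : Fact (0 < 2 * Real.pi) := ⟨by positivity⟩

/-- The `d`-dimensional torus `𝕋^d = [0,2π]^d` with endpoints identified. -/
abbrev Torus (d : ℕ) := Fin d → AddCircle (2 * Real.pi)

/-- The normalized Lebesgue measure `(2π)^{-d} dx` on the `d`-torus. -/
def torusMeasure (d : ℕ) : Measure (Torus d) :=
  ((ENNReal.ofReal (2 * Real.pi))⁻¹) ^ d • Measure.pi fun _ => volume

/-- The character `e^{i k·x}` on the `d`-torus. -/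
def torusChar {d : ℕ} (k : ZLat d) (x : Torus d) : ℂ :=
  ∏ j, fourier (k j) (x j)

/-- The `k`-th Fourier coefficient `f̂(k) = (2π)^{-d} ∫_{𝕋^d} f(x) e^{-i k·x} dx`. -/
def fourierCoef {d : ℕ} (f : Torus d → ℂ) (k : ZLat d) : ℂ :=
  ∫ x, (starRingEnd ℂ) (torusChar k x) * f x ∂(torusMeasure d)

/-- The `n`-th approximation number of a bounded linear operator `T`:
`a_n(T) = inf {‖T - A‖ : rank A < n}`. -/
def approxNum {X Y : Type*} [NormedAddCommGroup X] [NormedSpace ℂ X]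
    [NormedAddCommGroup Y] [NormedSpace ℂ Y] (T : X →L[ℂ] Y) (n : ℕ) : ℝ :=
  sInf {c : ℝ | ∃ A : X →L[ℂ] Y,
    Module.rank ℂ (LinearMap.range (A : X →ₗ[ℂ] Y)) < n ∧ c = ‖T - A‖}

/-- `ℓ²(ℤ^d)`; an isometric model of the Hilbert space `F_d(w)` via `f ↦ (w(k)·f̂(k))_k`.
Under this identification the embedding `I_d : F_d(w) → G` is characterized by the
property that the function `T c` has Fourier coefficients `c(k)/w(k)`. -/
abbrev ellTwo (d : ℕ) := lp (fun _ : ZLat d => ℂ) 2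

/-- `ℓ¹(ℤ^d)`; an isometric model of the Wiener algebra `A(𝕋^d)` via `f ↦ (f̂(k))_k`. -/
abbrev ellOne (d : ℕ) := lp (fun _ : ZLat d => ℂ) 1

/-- `ℓ^∞(ℤ^d)`; an isometric model of the space `ℬ(𝕋^d)` of distributions with bounded
Fourier coefficients. -/
abbrev ellInfty (d : ℕ) := lp (fun _ : ZLat d => ℂ) ⊤

theorem norm_torusChar {d : ℕ} (k : ZLat d) (x : Torus d) : ‖torusChar k x‖ = 1 := by
  simp only [torusChar, norm_prod, fourier_apply, Circle.norm_coe, Finset.prod_const_one]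

theorem continuous_torusChar {d : ℕ} (k : ZLat d) : Continuous (torusChar k) := by
  unfold torusChar
  fun_prop

theorem torusChar_sub {d : ℕ} (k l : ZLat d) (x : Torus d) :
    torusChar (k - l) x = torusChar k x * (starRingEnd ℂ) (torusChar l x) := by
  simp only [torusChar, map_prod, ← Finset.prod_mul_distrib, Pi.sub_apply, sub_eq_add_neg,
    fourier_add, fourier_neg]

instance isProbabilityMeasure_torusMeasure (d : ℕ) : IsProbabilityMeasure (torusMeasure d) := by
  constructor
  have h : ENNReal.ofReal (2 * Real.pi) ≠ 0 := by simp [Real.pi_pos]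
  simp only [torusMeasure, Measure.smul_apply, Measure.pi_univ, AddCircle.measure_univ,
    Finset.prod_const, Finset.card_univ, Fintype.card_fin, smul_eq_mul, ← mul_pow]
  rw [ENNReal.inv_mul_cancel h ENNReal.ofReal_ne_top, one_pow]

theorem integral_fourier_haarAddCircle (n : ℤ) :
    ∫ x : AddCircle (2 * Real.pi), fourier n x ∂AddCircle.haarAddCircle =
      if n = 0 then 1 else 0 := by
  split_ifs with h
  · simp [h]
  · exact integral_eq_zero_of_add_right_eq_neg (μ := AddCircle.haarAddCircle)
      (fourier_add_half_inv_index h Real.two_pi_pos)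

theorem integral_torusChar {d : ℕ} (k : ZLat d) :
    ∫ x, torusChar k x ∂torusMeasure d = if k = 0 then 1 else 0 := by
  have h (n : ℤ) : (2 * Real.pi : ℂ)⁻¹ * ∫ x : AddCircle (2 * Real.pi), fourier n x =
      if n = 0 then 1 else 0 := by
    rw [← integral_fourier_haarAddCircle, AddCircle.integral_haarAddCircle, Complex.real_smul]
    push_cast
    rfl
  rw [torusMeasure, integral_smul_measure]
  simp only [torusChar]
  rw [integral_fintype_prod_eq_prod (fun i (x : AddCircle (2 * Real.pi)) => fourier (k i) x)]
  rw [Complex.real_smul, ENNReal.toReal_pow, ENNReal.toReal_inv,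
    ENNReal.toReal_ofReal Real.two_pi_pos.le]
  have hc : ((((2 * Real.pi)⁻¹ ^ d : ℝ)) : ℂ) = ∏ _i : Fin d, (2 * Real.pi : ℂ)⁻¹ := by simp
  rw [hc, ← Finset.prod_mul_distrib]
  simp only [h, Finset.prod_ite_zero, Finset.prod_const_one, Finset.mem_univ, true_imp_iff,
    funext_iff, Pi.zero_apply]

theorem fourierCoef_torusChar {d : ℕ} (k l : ZLat d) :
    fourierCoef (torusChar l) k = if l = k then 1 else 0 := by
  simp only [fourierCoef, mul_comm, ← torusChar_sub, integral_torusChar, sub_eq_zero]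

theorem fourierCoef_congr_ae {d : ℕ} {f g : Torus d → ℂ} (h : f =ᵐ[torusMeasure d] g) :
    fourierCoef f = fourierCoef g := by
  ext k
  refine integral_congr_ae ?_
  filter_upwards [h] with x hx
  rw [hx]

/-- The synthesis operator `c ↦ ∑ₖ c k e^{i k·x}` from `ℓ¹(ℤ^d)` to `C(𝕋^d)`. -/
def synthesis (d : ℕ) : ellOne d →L[ℂ] C(Torus d, ℂ) :=
  (lp.tsumCLM ℂ (ZLat d) C(Torus d, ℂ)).comp
    (lp.mapCLM 1 (fun k : ZLat d => (ContinuousLinearMap.id ℂ ℂ).smulRight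
        (⟨torusChar k, continuous_torusChar k⟩ : C(Torus d, ℂ))) zero_le_one fun k => by
      rw [ContinuousLinearMap.norm_smulRight_apply]
      refine mul_le_one₀ ContinuousLinearMap.norm_id_le (norm_nonneg _) ?_
      exact (ContinuousMap.norm_le _ zero_le_one).2 fun x => (norm_torusChar k x).le)

theorem hasSum_synthesis {d : ℕ} (c : ellOne d) (x : Torus d) :
    HasSum (fun k => c k * torusChar k x) (synthesis d c x) := by
  have hs : Summable fun k => ‖c k‖ := by simpa using c.2.summable
  have h : Summable fun k : ZLat d =>
      c k • (⟨torusChar k, continuous_torusChar k⟩ : C(Torus d, ℂ)) := by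
    refine Summable.of_norm_bounded hs fun k => ?_
    refine (norm_smul_le _ _).trans (mul_le_of_le_one_right (norm_nonneg _) ?_)
    exact (ContinuousMap.norm_le _ zero_le_one).2 fun x => (norm_torusChar k x).le
  exact h.hasSum.mapL (ContinuousMap.evalCLM ℂ x)

theorem fourierCoef_synthesis {d : ℕ} (c : ellOne d) (k : ZLat d) :
    fourierCoef (synthesis d c) k = c k := by
  have hs : Summable fun k => ‖c k‖ := by simpa using c.2.summable
  have hI (l : ZLat d) : Integrable
      (fun x => (starRingEnd ℂ) (torusChar k x) * (c l * torusChar l x)) (torusMeasure d) := by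
    have h1 := continuous_torusChar k
    have h2 := continuous_torusChar l
    refine Integrable.of_bound (C := ‖c l‖) ?_ (.of_forall fun x => ?_)
    · exact Continuous.aestronglyMeasurable (by fun_prop)
    · simp [norm_torusChar]
  have h := hasSum_integral_of_summable_integral_norm hI (by simpa [norm_torusChar] using hs)
  have hf : fourierCoef (synthesis d c) k = ∫ x, ∑' l, (starRingEnd ℂ) (torusChar k x) *
      (c l * torusChar l x) ∂torusMeasure d :=
    integral_congr_ae (.of_forall fun x => (((hasSum_synthesis c x).mul_left _).tsum_eq).symm)
  rw [hf, ← h.tsum_eq]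
  have hc (l : ZLat d) : ∫ x, (starRingEnd ℂ) (torusChar k x) * (c l * torusChar l x)
      ∂torusMeasure d = if l = k then c l else 0 := by
    simp only [mul_left_comm _ (c l), integral_const_mul]
    have := fourierCoef_torusChar k l
    rw [fourierCoef] at this
    simp [this]
  simp [hc]

theorem norm_sum_fourierCoef_sub_le {d : ℕ} {g : Torus d → ℂ} {M : ℝ}
    (hg : AEStronglyMeasurable g (torusMeasure d)) (hM : ∀ᵐ x ∂torusMeasure d, ‖g x‖ ≤ M)
    (B : Finset (ZLat d)) :
    ‖∑ k ∈ B, ∑ l ∈ B, fourierCoef g (k - l)‖ ≤ B.card * M := by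
  set D : Torus d → ℂ := fun x => ∑ k ∈ B, torusChar k x with hD
  have hDc : Continuous D := continuous_finsetSum _ fun k _ => continuous_torusChar k
  have key (h : Torus d → ℂ) (hh : Integrable h (torusMeasure d)) :
      ∑ k ∈ B, ∑ l ∈ B, fourierCoef h (k - l) =
        ∫ x, (‖D x‖ ^ 2 : ℝ) * h x ∂torusMeasure d := by
    have hi (n : ZLat d) : Integrable (fun x => (starRingEnd ℂ) (torusChar n x) * h x)
        (torusMeasure d) := by
      refine hh.bdd_mul (c := 1) ?_ (.of_forall fun x => by simp [norm_torusChar])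
      have := continuous_torusChar n
      exact Continuous.aestronglyMeasurable (by fun_prop)
    simp only [fourierCoef]
    simp only [← integral_finsetSum _ fun i _ => hi _]
    rw [← integral_finsetSum _ fun k _ => integrable_finsetSum _ fun l _ => hi _]
    congr 1 with x
    rw [Complex.ofReal_pow, ← Complex.conj_mul', hD]
    simp only [map_sum, Finset.sum_mul_sum, torusChar_sub, map_mul, Complex.conj_conj]
    simp only [Finset.sum_mul]
  have hbd : ∫ x, ‖D x‖ ^ 2 ∂torusMeasure d = B.card := by
    have h1 := key (fun _ => 1) (integrable_const _)
    have h0 : (fun _ : Torus d => (1 : ℂ)) = torusChar 0 := by ext; simp [torusChar]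
    simp only [mul_one] at h1
    rw [integral_complex_ofReal, h0] at h1
    simp only [fourierCoef_torusChar] at h1
    have h2 (k : ZLat d) (hk : k ∈ B) :
        (∑ l ∈ B, if (0 : ZLat d) = k - l then (1 : ℂ) else 0) = 1 := by
      simp [eq_comm (a := (0 : ZLat d)), sub_eq_zero, hk]
    rw [Finset.sum_congr rfl h2] at h1
    simp only [Finset.sum_const, nsmul_eq_mul, mul_one] at h1
    exact_mod_cast h1.symm
  rw [key g (.of_bound hg M hM), ← hbd, ← integral_mul_const]
  refine norm_integral_le_of_norm_le ?_ ?_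
  · obtain ⟨C, hC⟩ := (isCompact_range hDc).isBounded.exists_norm_le
    refine Integrable.mul_const (.of_bound (C := C ^ 2) ?_ (.of_forall fun x => ?_)) M
    · exact (hDc.norm.pow 2).aestronglyMeasurable
    · rw [norm_pow, norm_norm]
      exact pow_le_pow_left₀ (norm_nonneg _) (hC _ ⟨x, rfl⟩) 2
  · filter_upwards [hM] with x hx
    rw [norm_mul, Complex.norm_real, norm_pow, norm_norm]
    gcongr

theorem exists_card_mul_sum_le {d : ℕ} (a : ZLat d → ℝ) (ha : ∀ k, 0 ≤ a k)
    (s : Finset (ZLat d)) :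
    ∃ B : Finset (ZLat d), 0 < B.card ∧
      B.card * ∑ j ∈ s, a j ≤ 2 ^ d * ∑ k ∈ B, ∑ l ∈ B, a (k - l) := by
  obtain ⟨R, hR⟩ : ∃ R : ℕ, ∀ k ∈ s, ∀ i, |k i| ≤ R := by
    refine ⟨∑ k ∈ s, ∑ i, (k i).natAbs, fun k hk i => ?_⟩
    rw [Int.abs_eq_natAbs]
    exact_mod_cast (Finset.single_le_sum (f := fun i => (k i).natAbs) (fun _ _ => Nat.zero_le _)
      (Finset.mem_univ i)).trans (Finset.single_le_sum (f := fun k : ZLat d =>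
        ∑ i, (k i).natAbs) (fun _ _ => Nat.zero_le _) hk)
  set B₀ : Finset (ZLat d) := Finset.Icc (fun _ => -(R : ℤ)) (fun _ => (R : ℤ)) with hB₀
  set B : Finset (ZLat d) := Finset.Icc (fun _ => -(2 * R : ℤ)) (fun _ => (2 * R : ℤ)) with hB
  have hc₀ : B₀.card = (2 * R + 1) ^ d := by
    simp only [hB₀, Pi.card_Icc, Int.card_Icc, Finset.prod_const, Finset.card_univ,
      Fintype.card_fin]
    congr 1; omega
  have hc : B.card = (4 * R + 1) ^ d := by
    simp only [hB, Pi.card_Icc, Int.card_Icc, Finset.prod_const, Finset.card_univ,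
      Fintype.card_fin]
    congr 1; omega
  have hsub : B₀ ⊆ B := by
    intro k hk
    simp only [hB₀, hB, Finset.mem_Icc, Pi.le_def] at hk ⊢
    exact ⟨fun i => by have := hk.1 i; omega, fun i => by have := hk.2 i; omega⟩
  have hshift (l : ZLat d) (hl : l ∈ B₀) : ∑ j ∈ s, a j ≤ ∑ k ∈ B, a (k - l) := by
    have : ∑ j ∈ s, a j = ∑ k ∈ s.map (addRightEmbedding l), a (k - l) := by simp
    rw [this]
    refine Finset.sum_le_sum_of_subset_of_nonneg ?_ fun _ _ _ => ha _
    intro k hk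
    obtain ⟨j, hj, rfl⟩ := Finset.mem_map.1 hk
    simp only [hB₀, hB, Finset.mem_Icc, Pi.le_def, addRightEmbedding_apply, Pi.add_apply]
      at hl ⊢
    refine ⟨fun i => ?_, fun i => ?_⟩ <;>
    · have h1 := abs_le.1 (hR j hj i)
      have h2 := hl.1 i
      have h3 := hl.2 i
      omega
  refine ⟨B, by rw [hc]; positivity, ?_⟩
  have hcard : (B.card : ℝ) ≤ 2 ^ d * B₀.card := by
    rw [hc, hc₀]
    push_cast
    rw [← mul_pow]
    gcongr
    linarith
  calc (B.card : ℝ) * ∑ j ∈ s, a j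
      ≤ 2 ^ d * B₀.card * ∑ j ∈ s, a j := by
        gcongr
        exact Finset.sum_nonneg fun _ _ => ha _
    _ = 2 ^ d * ∑ _l ∈ B₀, ∑ j ∈ s, a j := by
        rw [Finset.sum_const, nsmul_eq_mul, mul_assoc]
    _ ≤ 2 ^ d * ∑ l ∈ B, ∑ k ∈ B, a (k - l) := by
        gcongr
        exact (Finset.sum_le_sum hshift).trans (Finset.sum_le_sum_of_subset_of_nonneg hsub
          fun _ _ _ => Finset.sum_nonneg fun _ _ => ha _)
    _ = 2 ^ d * ∑ k ∈ B, ∑ l ∈ B, a (k - l) := by rw [Finset.sum_comm]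

theorem sum_le_of_fourierCoef_eq {d : ℕ} (g : Lp ℂ ⊤ (torusMeasure d)) (a : ZLat d → ℝ)
    (ha : ∀ k, 0 ≤ a k) (hga : ∀ k, fourierCoef g k = a k) (s : Finset (ZLat d)) :
    ∑ j ∈ s, a j ≤ 2 ^ d * ‖g‖ := by
  obtain ⟨B, hB, h⟩ := exists_card_mul_sum_le a ha s
  have hM : ∀ᵐ x ∂torusMeasure d, ‖g x‖ ≤ ‖g‖ := by
    have hfin := Lp.eLpNorm_ne_top g
    rw [Lp.norm_def]
    rw [eLpNorm_exponent_top] at hfin ⊢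
    filter_upwards [ae_le_eLpNormEssSup (f := g) (μ := torusMeasure d)] with x hx
    simpa using ENNReal.toReal_mono hfin hx
  have h2 := norm_sum_fourierCoef_sub_le (Lp.aestronglyMeasurable g) hM B
  simp only [hga, ← Complex.ofReal_sum, Complex.norm_real] at h2
  have h3 := (le_abs_self _).trans h2
  have hB' : (0 : ℝ) < B.card := by exact_mod_cast hB
  refine le_of_mul_le_mul_left (h.trans ?_) hB'
  calc _ ≤ 2 ^ d * (B.card * ‖g‖) := by gcongr
    _ = _ := by ring

theorem summable_of_embedding {d : ℕ} {w : ZLat d → ℝ}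
    (T : ellTwo d →L[ℂ] Lp ℂ ⊤ (torusMeasure d))
    (hT : ∀ (c : ellTwo d) (k : ZLat d), fourierCoef (⇑(T c)) k = c k / (w k : ℂ)) :
    Summable fun k : ZLat d => (w k)⁻¹ ^ 2 := by
  refine summable_of_sum_le (c := (2 ^ d * ‖T‖) ^ 2) (fun k => sq_nonneg _) fun s => ?_
  set A := ∑ k ∈ s, (w k)⁻¹ ^ 2 with hA
  set c : ellTwo d := ∑ k ∈ s, lp.single 2 k ((w k)⁻¹ : ℂ) with hc
  have hcn : ‖c‖ ^ 2 = A := by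
    have := lp.norm_sum_single (E := fun _ : ZLat d => ℂ) (p := 2) (by simp)
      (fun k => ((w k)⁻¹ : ℂ)) s
    simpa [hA] using this
  have hck (k : ZLat d) : c k = if k ∈ s then ((w k)⁻¹ : ℂ) else 0 := by
    rw [hc, lp.coeFn_sum, Finset.sum_apply]
    simp [Pi.single_apply]
  have h := sum_le_of_fourierCoef_eq (T c) (fun k => if k ∈ s then (w k)⁻¹ ^ 2 else 0)
    (fun k => by positivity) (fun k => by
      rw [hT, hck]
      split_ifs
      · push_cast
        ring
      · simp) s
  rw [Finset.sum_congr rfl fun k hk => if_pos hk, ← hA] at h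
  have h2 : A ≤ 2 ^ d * ‖T‖ * ‖c‖ := by
    rw [mul_assoc]
    exact h.trans (by gcongr; exact T.le_opNorm c)
  rw [← hcn] at h2 ⊢
  have h3 : ‖c‖ ≤ 2 ^ d * ‖T‖ := by
    by_contra! hlt
    nlinarith [mul_nonneg (by positivity : (0 : ℝ) ≤ 2 ^ d) (norm_nonneg T)]
  gcongr

/-- Coordinatewise multiplication `ℓ² × ℓ² → ℓ¹`, as a continuous bilinear map. -/
def ellTwoMul (d : ℕ) : ellTwo d →L[ℂ] ellTwo d →L[ℂ] ellOne d :=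
  lp.holderL 1 (fun _ => ContinuousLinearMap.mul ℂ ℂ) (K := 1) fun _ => by simp

theorem ellTwoMul_apply {d : ℕ} (b c : ellTwo d) (k : ZLat d) :
    ellTwoMul d b c k = b k * c k := rfl

theorem isCompactOperator_ellTwoMul {d : ℕ} (b : ellTwo d) :
    IsCompactOperator (ellTwoMul d b) := by
  have hsum := (lp.hasSum_single (by simp) b).mapL (ellTwoMul d)
  refine isCompactOperator_of_tendsto hsum (.of_forall fun s => ?_)
  refine Submodule.sum_mem (compactOperator (RingHom.id ℂ) (ellTwo d) (ellOne d))
    fun k _ => ?_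
  have hfac : ellTwoMul d (lp.single 2 k (b k)) =
      (lp.singleContinuousLinearMap ℂ (fun _ : ZLat d => ℂ) 1 k).comp
        (b k • lp.evalCLM ℂ (fun _ : ZLat d => ℂ) 2 k) := by
    ext c j
    rw [ellTwoMul_apply]
    by_cases h : j = k
    · subst h
      simp only [lp.single_apply_self, ContinuousLinearMap.comp_apply,
        lp.singleContinuousLinearMap_apply]
      rfl
    · simp [h]
  rw [hfac]
  exact (isCompactOperator_of_locallyCompactSpace_dom
    (b k • lp.evalCLM ℂ (fun _ : ZLat d => ℂ) 2 k)).clm_comp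
      (lp.singleContinuousLinearMap ℂ (fun _ : ZLat d => ℂ) 1 k)

/-- Theorem 1 of Cobos–Kühn–Sickel. For a weight `w : ℤ^d → (0,∞)`,
the following are equivalent: the embedding of `F_d(w)` into the Wiener algebra
(modelled as the diagonal-type operator `ℓ² → ℓ¹`, `c ↦ (c k / w k)`) exists and is
compact / bounded; the embedding into `C(𝕋^d)` (characterized by Fourier coefficients)
exists and is compact / bounded; the embedding into `L_∞(𝕋^d)` exists and is compact /
bounded; and `∑_k w(k)^{-2} < ∞`. -/
theorem statement0 (d : ℕ) (hd : 0 < d) (w : ZLat d → ℝ) (hw : ∀ k, 0 < w k) :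
    List.TFAE
      [ -- (i) `F_d(w) ↪ A(𝕋^d)` compactly
        (∃ T : ellTwo d →L[ℂ] ellOne d,
          (∀ (c : ellTwo d) (k : ZLat d), T c k = c k / (w k : ℂ)) ∧ IsCompactOperator (⇑T)),
        -- (ii) `F_d(w) ↪ A(𝕋^d)` boundedly
        (∃ T : ellTwo d →L[ℂ] ellOne d,
          ∀ (c : ellTwo d) (k : ZLat d), T c k = c k / (w k : ℂ)),
        -- (iii) `F_d(w) ↪ C(𝕋^d)` compactly
        (∃ T : ellTwo d →L[ℂ] C(Torus d, ℂ),
          (∀ (c : ellTwo d) (k : ZLat d), fourierCoef (⇑(T c)) k = c k / (w k : ℂ)) ∧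
            IsCompactOperator (⇑T)),
        -- (iv) `F_d(w) ↪ C(𝕋^d)` boundedly
        (∃ T : ellTwo d →L[ℂ] C(Torus d, ℂ),
          ∀ (c : ellTwo d) (k : ZLat d), fourierCoef (⇑(T c)) k = c k / (w k : ℂ)),
        -- (v) `F_d(w) ↪ L_∞(𝕋^d)` compactly
        (∃ T : ellTwo d →L[ℂ] Lp ℂ ⊤ (torusMeasure d),
          (∀ (c : ellTwo d) (k : ZLat d), fourierCoef (⇑(T c)) k = c k / (w k : ℂ)) ∧
            IsCompactOperator (⇑T)),
        -- (vi) `F_d(w) ↪ L_∞(𝕋^d)` boundedly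
        (∃ T : ellTwo d →L[ℂ] Lp ℂ ⊤ (torusMeasure d),
          ∀ (c : ellTwo d) (k : ZLat d), fourierCoef (⇑(T c)) k = c k / (w k : ℂ)),
        -- (vii) `∑_k w(k)^{-2} < ∞`
        (Summable fun k : ZLat d => (w k)⁻¹ ^ 2) ] := by
  tfae_have 7 → 1 := fun h => by
    let b : ellTwo d := ⟨fun k => ((w k)⁻¹ : ℂ), memℓp_gen (by simpa using h)⟩
    refine ⟨ellTwoMul d b, fun c k => ?_, isCompactOperator_ellTwoMul b⟩
    rw [ellTwoMul_apply, div_eq_inv_mul]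
  tfae_have 1 → 2 := fun ⟨T, hT, _⟩ => ⟨T, hT⟩
  tfae_have 2 → 4 := fun ⟨T, hT⟩ => ⟨(synthesis d).comp T, fun c k => by
    rw [ContinuousLinearMap.comp_apply, fourierCoef_synthesis, hT]⟩
  tfae_have 1 → 3 := fun ⟨T, hT, hc⟩ => ⟨(synthesis d).comp T, fun c k => by
    rw [ContinuousLinearMap.comp_apply, fourierCoef_synthesis, hT],
      hc.clm_comp (synthesis d)⟩
  tfae_have 4 → 6 := fun ⟨T, hT⟩ =>
    ⟨(ContinuousMap.toLp ⊤ (torusMeasure d) ℂ).comp T, fun c k => by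
      rw [ContinuousLinearMap.comp_apply,
        fourierCoef_congr_ae (ContinuousMap.coeFn_toLp (torusMeasure d) (T c)), hT]⟩
  tfae_have 3 → 5 := fun ⟨T, hT, hc⟩ =>
    ⟨(ContinuousMap.toLp ⊤ (torusMeasure d) ℂ).comp T, fun c k => by
      rw [ContinuousLinearMap.comp_apply,
        fourierCoef_congr_ae (ContinuousMap.coeFn_toLp (torusMeasure d) (T c)), hT],
      hc.clm_comp (ContinuousMap.toLp ⊤ (torusMeasure d) ℂ)⟩
  tfae_have 5 → 6 := fun ⟨T, hT, _⟩ => ⟨T, hT⟩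
  tfae_have 6 → 7 := fun ⟨T, hT⟩ => summable_of_embedding T hT
  tfae_finish
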